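/- arXiv:2508.14238 — 4 statements merged into one kernel-verified Lean document; each statement's English description precedes it below -/
import Mathlib

section
/- Let T be a spider with n vertices whose center has degree Δ ≥ 3 (so T has Δ legs), and suppose at least two legs of T have length at least 2 (equivalently, the center has at least two neighbors of degree 2). Then there exists another spider T' with n vertices and Δ legs such that HM₁(T) > HM₁(T') and HM₂(T) > HM₂(T'). -/
/-- The degree of a vertex (classical version, no decidability assumptions). -/
noncomputable def deg {V : Type*} [Fintype V] (G : SimpleGraph V) (v : V) : ℕ := by
  classical exact G.degree v

/-- The first hyper-Zagreb index `HM₁(G) = Σ_{uv ∈ E(G)} (deg u + deg v)²`. -/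
noncomputable def HM1 {V : Type*} [Fintype V] (G : SimpleGraph V) : ℕ := by
  classical
  exact ∑ e ∈ G.edgeFinset,
    Sym2.lift ⟨fun u v => (G.degree u + G.degree v) ^ 2, fun u v => by ring⟩ e

/-- The second hyper-Zagreb index `HM₂(G) = Σ_{uv ∈ E(G)} (deg u · deg v)²`. -/
noncomputable def HM2 {V : Type*} [Fintype V] (G : SimpleGraph V) : ℕ := by
  classical
  exact ∑ e ∈ G.edgeFinset,
    Sym2.lift ⟨fun u v => (G.degree u * G.degree v) ^ 2, fun u v => by ring⟩ e

/-- `G` is a spider with center `c`: a tree whose unique vertex of degree at least 3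
is `c`. -/
def IsSpiderWithCenter {V : Type*} [Fintype V] (G : SimpleGraph V) (c : V) : Prop :=
  G.IsTree ∧ 3 ≤ deg G c ∧ ∀ v, 3 ≤ deg G v → v = c

open SimpleGraph

/-- The sum over the edges `uv` of `G` of the weight `g s(deg u, deg v)`. -/
noncomputable def edgeDegreeSum {V : Type*} [Fintype V] (G : SimpleGraph V)
    (g : Sym2 ℕ → ℕ) : ℕ := by
  classical exact ∑ e ∈ G.edgeFinset, g (e.map (deg G))

/-- The weight whose edge-degree sum is the first hyper-Zagreb index. -/
def sqAdd : Sym2 ℕ → ℕ :=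
  Sym2.lift ⟨fun a b => (a + b) ^ 2, fun a b => by ring⟩

/-- The weight whose edge-degree sum is the second hyper-Zagreb index. -/
def sqMul : Sym2 ℕ → ℕ :=
  Sym2.lift ⟨fun a b => (a * b) ^ 2, fun a b => by ring⟩

theorem HM1_eq_edgeDegreeSum {V : Type*} [Fintype V] (G : SimpleGraph V) :
    HM1 G = edgeDegreeSum G sqAdd := by
  classical
  refine Finset.sum_congr rfl fun e _ => ?_
  induction e with
  | h u v => rfl

theorem HM2_eq_edgeDegreeSum {V : Type*} [Fintype V] (G : SimpleGraph V) :
    HM2 G = edgeDegreeSum G sqMul := by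
  classical
  refine Finset.sum_congr rfl fun e _ => ?_
  induction e with
  | h u v => rfl

/-- In a finite acyclic graph, a vertex `c` that starts a path of length at least two
reaches a vertex all of whose neighbors coincide with a single vertex other than `c`. -/
theorem exists_reachable_leaf {V : Type*} [Fintype V] {H : SimpleGraph V} (hH : H.IsAcyclic)
    {c x : V} {q : H.Walk c x} (hq : q.IsPath) (hlen : 2 ≤ q.length) :
    ∃ l p, H.Reachable c l ∧ H.Adj l p ∧ (∀ z, H.Adj l z → z = p) ∧ p ≠ c ∧ l ≠ c := by
  classical
  let P : ℕ → Prop := fun k => ∃ (y : V) (r : H.Walk c y), r.IsPath ∧ r.length = k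
  have hqb : q.length ≤ Fintype.card V := hq.length_lt.le
  have hPq : P q.length := ⟨x, q, hq, rfl⟩
  obtain ⟨l, r, hr, hrlen⟩ := Nat.findGreatest_spec hqb hPq
  have hle : 2 ≤ r.length := hrlen ▸ hlen.trans (Nat.le_findGreatest hqb hPq)
  have hnil : ¬ r.Nil := fun h => by
    have := Walk.length_eq_zero_iff.2 h
    omega
  refine ⟨l, r.penultimate, ⟨r⟩, (r.adj_penultimate hnil).symm, fun z hz => ?_, fun h => ?_,
    fun h => ?_⟩
  · refine hH.eq_penultimate_of_adj_end hr hz ?_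
    by_contra hmem
    have hr' := hr.concat hmem hz
    have := Nat.le_findGreatest (P := P) hr'.length_lt.le ⟨z, _, hr', rfl⟩
    rw [Walk.length_concat] at this
    omega
  · have := (hr.getVert_eq_start_iff (i := r.length - 1) (by omega)).1 h
    omega
  · subst h
    exact hnil (Walk.isPath_iff_nil.1 hr)

/-- The graph obtained from `G` by replacing the edge `aw` by the edge `lw`. -/
def transplant {V : Type*} (G : SimpleGraph V) (a w l : V) : SimpleGraph V :=
  G.deleteEdges {s(a, w)} ⊔ edge l w

theorem transplant_adj {V : Type*} {G : SimpleGraph V} {a w l u v : V} (hlw : l ≠ w) :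
    (transplant G a w l).Adj u v ↔ (G.Adj u v ∧ s(u, v) ≠ s(a, w)) ∨ s(u, v) = s(l, w) := by
  simp only [transplant, sup_adj, deleteEdges_adj, Set.mem_singleton_iff, edge_adj, Sym2.eq_iff]
  grind

theorem deg_transplant_add {V : Type*} [Fintype V] [DecidableEq V] {G : SimpleGraph V}
    {a w l : V} (haw : G.Adj a w) (hlw : l ≠ w) (hla : l ≠ a) (hn : ¬ G.Adj l w) (v : V) :
    deg (transplant G a w l) v + (if v = a then 1 else 0) =
      deg G v + (if v = l then 1 else 0) := by
  classical
  have hne := haw.ne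
  have hmem : ∀ z, z ∈ (transplant G a w l).neighborFinset v ↔
      (G.Adj v z ∧ s(v, z) ≠ s(a, w)) ∨ s(v, z) = s(l, w) := fun z => by
    rw [mem_neighborFinset, transplant_adj hlw]
  simp only [deg, ← card_neighborFinset_eq_degree]
  by_cases hva : v = a
  · subst hva
    have : (transplant G v w l).neighborFinset v = (G.neighborFinset v).erase w := by
      ext z
      rw [hmem]
      simp only [Finset.mem_erase, mem_neighborFinset, Sym2.eq_iff]
      grind
    rw [this, if_pos rfl, if_neg hla.symm, Finset.card_erase_add_one (by simpa using haw)]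
    rfl
  by_cases hvl : v = l
  · subst hvl
    have : (transplant G a w v).neighborFinset v = insert w (G.neighborFinset v) := by
      ext z
      rw [hmem]
      simp only [Finset.mem_insert, mem_neighborFinset, Sym2.eq_iff]
      grind
    rw [this, if_pos rfl, if_neg hla, Finset.card_insert_of_notMem (by simpa using hn)]
  rw [if_neg hva, if_neg hvl]
  by_cases hvw : v = w
  · subst hvw
    have : (transplant G a v l).neighborFinset v =
        insert l ((G.neighborFinset v).erase a) := by
      ext z
      rw [hmem]
      simp only [Finset.mem_insert, Finset.mem_erase, mem_neighborFinset, Sym2.eq_iff]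
      grind
    rw [this, Finset.card_insert_of_notMem (by simpa [hla] using fun h => hn h.symm),
      Finset.card_erase_add_one (by simpa using haw.symm)]
    rfl
  · have : (transplant G a w l).neighborFinset v = G.neighborFinset v := by
      ext z
      rw [hmem]
      simp only [mem_neighborFinset, Sym2.eq_iff]
      grind
    rw [this]

/-- Moving the pendant part at `w` from `a`, whose only other neighbor is `c`, to a leaf `l`
with neighbor `p` changes exactly the contributions of the edges `ca` and `lp`. -/
theorem edgeDegreeSum_transplant {V : Type*} [Fintype V] {G : SimpleGraph V} {a c w l p : V}
    (haw : G.Adj a w) (hac : G.Adj a c) (hcw : c ≠ w) (ha : ∀ z, G.Adj a z → z = c ∨ z = w)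
    (hlp : G.Adj l p) (hl : ∀ z, G.Adj l z → z = p) (hlw : l ≠ w) (hla : l ≠ a) (hlc : l ≠ c)
    (hn : ¬ G.Adj l w) (g : Sym2 ℕ → ℕ) :
    edgeDegreeSum (transplant G a w l) g + g s(deg G a, deg G c) + g s(deg G l, deg G p) +
        g s(deg G a, deg G w) =
      edgeDegreeSum G g + g s(deg G a - 1, deg G c) + g s(deg G l + 1, deg G p) +
        g s(deg G l + 1, deg G w) := by
  classical
  have hdeg := deg_transplant_add haw hlw hla hn
  have hpl := hlp.ne
  have hpa : p ≠ a := by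
    rintro rfl
    rcases ha l hlp.symm with h | h <;> contradiction
  have hca := hac.ne
  have hwa := haw.ne
  have hda : deg (transplant G a w l) a = deg G a - 1 := by
    have := hdeg a
    simp only [if_true, if_neg hla.symm] at this
    omega
  have hdl : deg (transplant G a w l) l = deg G l + 1 := by
    have := hdeg l
    simp only [if_true, if_neg hla] at this
    omega
  have hdo : ∀ v, v ≠ a → v ≠ l → deg (transplant G a w l) v = deg G v := fun v h₁ h₂ => by
    have := hdeg v
    simp only [if_neg h₁, if_neg h₂] at this
    omega
  set R : Finset (Sym2 V) := ((G.edgeFinset.erase s(a, w)).erase s(a, c)).erase s(l, p) with hR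
  have hE : G.edgeFinset = insert s(a, w) (insert s(a, c) (insert s(l, p) R)) := by
    ext e
    simp only [hR, Finset.mem_insert, Finset.mem_erase, mem_edgeFinset]
    have h₁ : s(a, w) ∈ G.edgeSet := haw
    have h₂ : s(a, c) ∈ G.edgeSet := hac
    have h₃ : s(l, p) ∈ G.edgeSet := hlp
    grind
  have hE' : (transplant G a w l).edgeFinset =
      insert s(l, w) (insert s(a, c) (insert s(l, p) R)) := by
    ext e
    induction e with
    | h u v =>
      simp only [hR, Finset.mem_insert, Finset.mem_erase, mem_edgeFinset, mem_edgeSet,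
        transplant_adj hlw]
      have h₂ : s(a, c) ∈ G.edgeSet := hac
      have h₃ : s(l, p) ∈ G.edgeSet := hlp
      have h₄ : s(a, c) ≠ s(a, w) := by simp only [ne_eq, Sym2.eq_iff]; grind
      have h₅ : s(l, p) ≠ s(a, w) := by simp only [ne_eq, Sym2.eq_iff]; grind
      rw [← mem_edgeSet]
      grind
  have h₁ : s(l, p) ∉ R := by simp [hR]
  have h₂ : s(a, c) ∉ insert s(l, p) R := by
    simp only [hR, Finset.mem_insert, Finset.mem_erase, Sym2.eq_iff]; grind
  have h₃ : s(a, w) ∉ insert s(a, c) (insert s(l, p) R) := by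
    simp only [hR, Finset.mem_insert, Finset.mem_erase, Sym2.eq_iff]; grind
  have h₄ : s(l, w) ∉ insert s(a, c) (insert s(l, p) R) := by
    simp only [hR, Finset.mem_insert, Finset.mem_erase, mem_edgeFinset, mem_edgeSet, Sym2.eq_iff]
    grind
  have hsum : ∑ e ∈ R, g (e.map (deg (transplant G a w l))) = ∑ e ∈ R, g (e.map (deg G)) := by
    refine Finset.sum_congr rfl fun e he => ?_
    induction e with
    | h u v =>
      simp only [hR, Finset.mem_erase, mem_edgeFinset, mem_edgeSet, ne_eq, Sym2.eq_iff] at he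
      have := he.2.2.2.symm
      rw [Sym2.map_mk, Sym2.map_mk, hdo u, hdo v] <;> grind
  simp only [edgeDegreeSum]
  rw [hE, hE']
  simp only [Finset.sum_insert h₄, Finset.sum_insert h₃, Finset.sum_insert h₂,
    Finset.sum_insert h₁, hsum, Sym2.map_mk, hda, hdl, hdo c hca.symm hlc.symm,
    hdo w hwa.symm hlw.symm, hdo p hpa hpl.symm]
  ring

theorem isTree_transplant {V : Type*} {G : SimpleGraph V} (hG : G.IsTree) {a w l : V}
    (haw : G.Adj a w) (hal : (G.deleteEdges {s(a, w)}).Reachable a l) :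
    (transplant G a w l).IsTree := by
  have hbr : ¬ (G.deleteEdges {s(a, w)}).Reachable a w :=
    isBridge_iff.1 (isAcyclic_iff_forall_adj_isBridge.1 hG.isAcyclic haw)
  have hlw : ¬ (G.deleteEdges {s(a, w)}).Reachable l w := fun h => hbr (hal.trans h)
  have hne : l ≠ w := fun h => hlw (h ▸ Reachable.refl _)
  have hawr : (transplant G a w l).Reachable a w :=
    (hal.mono le_sup_left).trans (Adj.reachable ((transplant_adj hne).2 (Or.inr rfl)))
  have : Nonempty V := ⟨a⟩
  refine ⟨⟨fun u v => ?_⟩, (hG.isAcyclic.anti (deleteEdges_le _)).sup_edge_of_not_reachable hlw⟩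
  obtain ⟨p⟩ := hG.connected u v
  induction p with
  | nil => rfl
  | @cons x y z h _ ih =>
    refine Reachable.trans ?_ ih
    by_cases he : s(x, y) = s(a, w)
    · rcases Sym2.eq_iff.1 he with ⟨rfl, rfl⟩ | ⟨rfl, rfl⟩
      exacts [hawr, hawr.symm]
    · exact Adj.reachable ((transplant_adj hne).2 (Or.inl ⟨h, he⟩))

/-- A neighbor `c` of a vertex `a` of degree two comes with a second neighbor `w`. -/
theorem exists_other_neighbor {V : Type*} [Fintype V] {G : SimpleGraph V} {a c : V}
    (hac : G.Adj a c) (ha : deg G a = 2) :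
    ∃ w, G.Adj a w ∧ w ≠ c ∧ ∀ z, G.Adj a z → z = c ∨ z = w := by
  classical
  have hc : c ∈ G.neighborFinset a := by simpa using hac
  have hcard : (G.neighborFinset a).card = 2 := by
    rw [card_neighborFinset_eq_degree, ← ha]; rfl
  obtain ⟨w, hw⟩ := Finset.card_eq_one.1
    (show ((G.neighborFinset a).erase c).card = 1 by rw [Finset.card_erase_of_mem hc, hcard])
  have key : ∀ z, z ≠ c ∧ G.Adj a z ↔ z = w := fun z => by
    simpa using Finset.ext_iff.1 hw z
  exact ⟨w, ((key w).2 rfl).2, ((key w).2 rfl).1, fun z hz => by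
    by_cases h : z = c
    exacts [Or.inl h, Or.inr ((key z).1 ⟨h, hz⟩)]⟩

theorem stmt2 (n Δ : ℕ) (hΔ : 3 ≤ Δ) (T : SimpleGraph (Fin n)) (c : Fin n)
    (hspider : IsSpiderWithCenter T c) (hdeg : deg T c = Δ)
    (htwolegs : 2 ≤ {v | T.Adj c v ∧ deg T v = 2}.ncard) :
    ∃ (T' : SimpleGraph (Fin n)) (c' : Fin n), IsSpiderWithCenter T' c' ∧ deg T' c' = Δ ∧
      HM1 T' < HM1 T ∧ HM2 T' < HM2 T := by
  obtain ⟨htree, -, huniq⟩ := hspider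
  obtain ⟨a, ⟨hca, ha2⟩, b, ⟨hcb, hb2⟩, hab⟩ :=
    (Set.one_lt_ncard (Set.toFinite _)).1 (show 1 < _ from htwolegs)
  obtain ⟨w, haw, hwc, ha⟩ := exists_other_neighbor hca.symm ha2
  obtain ⟨x, hbx, hxc, hb⟩ := exists_other_neighbor hcb.symm hb2
  set H := T.deleteEdges {s(a, w)} with hH
  have hHacyc : H.IsAcyclic := htree.isAcyclic.anti (deleteEdges_le _)
  have hbr : ¬ H.Reachable a w :=
    isBridge_iff.1 (isAcyclic_iff_forall_adj_isBridge.1 htree.isAcyclic haw)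
  have hHadj : ∀ u v, H.Adj u v ↔ T.Adj u v ∧ s(u, v) ≠ s(a, w) := fun u v => by
    simp [hH, deleteEdges_adj]
  have hHca : H.Adj c a := by
    rw [hHadj, ne_eq, Sym2.eq_iff]
    exact ⟨hca, by have := hca.ne; grind⟩
  have hHcb : H.Adj c b := by
    rw [hHadj, ne_eq, Sym2.eq_iff]
    exact ⟨hcb, by have := hca.ne; grind⟩
  have hbw : b ≠ w := by
    rintro rfl
    exact hbr (hHca.symm.reachable.trans hHcb.reachable)
  have hHbx : H.Adj b x := by
    rw [hHadj, ne_eq, Sym2.eq_iff]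
    exact ⟨hbx, by grind⟩
  obtain ⟨l, p, hcl, hHlp, hHl, hpc, hlc⟩ := exists_reachable_leaf hHacyc
    (q := Walk.cons hHcb (Walk.cons hHbx Walk.nil))
    (by simp [Walk.cons_isPath_iff, hbx.ne, hcb.ne, hxc.symm]) (by simp)
  have hal : H.Reachable a l := hHca.symm.reachable.trans hcl
  have hlw : l ≠ w := fun h => hbr (h ▸ hal)
  have hla : l ≠ a := by
    rintro rfl
    exact hpc (hHl c hHca.symm).symm
  have hTH : ∀ z, T.Adj l z → H.Adj l z := fun z hz => by
    rw [hHadj, ne_eq, Sym2.eq_iff]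
    exact ⟨hz, by grind⟩
  have hn : ¬ T.Adj l w := fun h => hbr (hal.trans (hTH w h).reachable)
  have hlp : T.Adj l p := ((hHadj _ _).1 hHlp).1
  have hl : ∀ z, T.Adj l z → z = p := fun z hz => hHl z (hTH z hz)
  have hl1 : deg T l = 1 := by
    classical
    exact degree_eq_one_iff_existsUnique_adj.2 ⟨p, hlp, hl⟩
  have hp2 : deg T p ≤ 2 := by
    by_contra h
    exact hpc (huniq p (by omega))
  have hdeg' := deg_transplant_add haw hlw hla hn
  have hcdeg : deg (transplant T a w l) c = Δ := by
    have := hdeg' c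
    rw [if_neg hca.ne, if_neg hlc.symm] at this
    omega
  have hsum := edgeDegreeSum_transplant haw hca.symm hwc.symm ha hlp hl hlw hla hlc hn
  rw [ha2, hl1, hdeg] at hsum
  refine ⟨transplant T a w l, c, ⟨isTree_transplant htree haw hal, by omega, fun v hv => ?_⟩,
    hcdeg, ?_, ?_⟩
  · by_contra hvc
    have hT : deg T v ≤ 2 := by
      by_contra h
      exact hvc (huniq v (by omega))
    have := hdeg' v
    by_cases hvl : v = l
    · rw [hvl] at this hv
      rw [if_neg hla, if_pos rfl] at this
      omega
    · rw [if_neg hvl] at this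
      omega
  · have h := hsum sqAdd
    rw [HM1_eq_edgeDegreeSum, HM1_eq_edgeDegreeSum]
    simp only [sqAdd, Sym2.lift_mk] at h ⊢
    nlinarith
  · have h := hsum sqMul
    rw [HM2_eq_edgeDegreeSum, HM2_eq_edgeDegreeSum]
    simp only [sqMul, Sym2.lift_mk] at h ⊢
    nlinarith
end

section
/- Let T be a tree with n vertices and maximum degree Δ, and let ρ ∈ V(T) be a vertex with deg(ρ) = Δ. If T contains a support vertex distinct from ρ whose degree is at least 3, then there exists a tree T' with n vertices and maximum degree Δ such that HM₁(T) > HM₁(T') and HM₂(T) > HM₂(T'). -/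
/-- The maximum degree of a graph (classical version). -/
noncomputable def maxDeg {V : Type*} [Fintype V] (G : SimpleGraph V) : ℕ := by
  classical exact G.maxDegree

/-- A support vertex: a vertex adjacent to a leaf (a vertex of degree 1). -/
def IsSupportVertex {V : Type*} [Fintype V] (G : SimpleGraph V) (v : V) : Prop :=
  ∃ u, G.Adj v u ∧ deg G u = 1

/-- An end-support vertex: a support vertex all of whose neighbors except exactly one
are leaves. -/
def IsEndSupportVertex {V : Type*} [Fintype V] (G : SimpleGraph V) (v : V) : Prop :=
  IsSupportVertex G v ∧ {u | G.Adj v u ∧ deg G u ≠ 1}.ncard = 1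

namespace SimpleGraph

variable {V : Type*} {G : SimpleGraph V}

/-- In a tree, every vertex has at most one neighbor that is closer to a given root. -/
lemma IsTree.eq_of_adj_of_dist_lt (hG : G.IsTree) {r x a b : V} (ha : G.Adj a x) (hb : G.Adj b x)
    (hda : G.dist r x = G.dist r a + 1) (hdb : G.dist r x = G.dist r b + 1) : a = b := by
  obtain ⟨p, hp⟩ := hG.connected.exists_walk_length_eq_dist r a
  obtain ⟨q, hq⟩ := hG.connected.exists_walk_length_eq_dist r b
  have hp' : (p.concat ha).IsPath :=
    Walk.isPath_of_length_eq_dist _ (by rw [Walk.length_concat, hp, hda])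
  have hq' : (q.concat hb).IsPath :=
    Walk.isPath_of_length_eq_dist _ (by rw [Walk.length_concat, hq, hdb])
  exact (Walk.concat_inj ((hG.existsUnique_path r x).unique hp' hq')).1

/-- Let `u` be a leaf attached to a vertex `v` of degree at least 3 in a finite tree with root `r`.
Then there is another leaf `w`, attached to `v` or to a vertex farther from the root than `v`. -/
lemma IsTree.exists_leaf_beyond [Fintype V] [DecidableRel G.Adj] (hG : G.IsTree) (r : V) {u v : V}
    (huv : G.Adj v u) (hu : G.degree u = 1) (hv : 3 ≤ G.degree v) :
    ∃ w w', w ≠ u ∧ G.Adj w w' ∧ G.degree w = 1 ∧ (w' = v ∨ G.dist r v < G.dist r w') := by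
  classical
  have hu' : ∀ y, G.Adj y u → y = v := fun y hy =>
    (degree_eq_one_iff_existsUnique_adj.1 hu).unique hy.symm huv.symm
  let S : Finset V := {x | G.dist r x = G.dist r v + G.dist v x ∧ x ≠ u ∧ x ≠ v}
  have hS : S.Nonempty := by
    have hcard : 1 < ((G.neighborFinset v).erase u).card := by
      rw [Finset.card_erase_of_mem (by simpa using huv), card_neighborFinset_eq_degree]
      omega
    obtain ⟨a, ha, b, hb, hab⟩ := Finset.one_lt_card.1 hcard
    simp only [Finset.mem_erase, mem_neighborFinset] at ha hb
    have child : ∀ c, c ≠ u → G.Adj v c → G.dist r c = G.dist r v + 1 → S.Nonempty := by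
      intro c hcu hc hd
      refine ⟨c, ?_⟩
      simp only [S, Finset.mem_filter, Finset.mem_univ, true_and]
      exact ⟨by rw [hd, dist_eq_one_iff_adj.2 hc], hcu, hc.ne'⟩
    rcases hG.dist_eq_dist_add_one_of_adj r ha.2 with h1 | h1
    · rcases hG.dist_eq_dist_add_one_of_adj r hb.2 with h2 | h2
      · exact absurd (hG.eq_of_adj_of_dist_lt ha.2.symm hb.2.symm h1 h2) hab
      · exact child b hb.1 hb.2 h2
    · exact child a ha.1 ha.2 h1
  obtain ⟨w, hwS, hmax⟩ := S.exists_max_image (G.dist r) hS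
  have hw : G.dist r w = G.dist r v + G.dist v w ∧ w ≠ u ∧ w ≠ v := by simpa [S] using hwS
  obtain ⟨hwd, hwu, hwv⟩ := hw
  have hparent : ∀ y, G.Adj w y → G.dist r w = G.dist r y + 1 := by
    intro y hy
    rcases hG.dist_eq_dist_add_one_of_adj r hy with h | h
    · exact h
    · have h1 : G.dist r y ≤ G.dist r v + G.dist v y := hG.connected.dist_triangle
      have h2 : G.dist v y ≤ G.dist v w + G.dist w y := hG.connected.dist_triangle
      rw [dist_eq_one_iff_adj.2 hy] at h2
      have hyS : y ∈ S := by
        simp only [S, Finset.mem_filter, Finset.mem_univ, true_and]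
        refine ⟨by omega, ?_, ?_⟩
        · rintro rfl
          exact hwv (hu' w hy)
        · rintro rfl
          omega
      have := hmax y hyS
      omega
  have : Nontrivial V := ⟨w, v, hwv⟩
  have hpos : 0 < G.degree w := hG.connected.preconnected.degree_pos_of_nontrivial w
  obtain ⟨w', hw'⟩ := (G.degree_pos_iff_exists_adj w).1 hpos
  have hd' := hparent w' hw'
  refine ⟨w, w', hwu, hw', ?_, ?_⟩
  · exact degree_eq_one_iff_existsUnique_adj.2 ⟨w', hw', fun y hy =>
      hG.eq_of_adj_of_dist_lt hy.symm hw'.symm (hparent y hy) hd'⟩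
  · have hvw : 0 < G.dist v w := hG.connected.pos_dist_of_ne hwv.symm
    by_cases h1 : G.dist v w = 1
    · have hadj : G.Adj v w := dist_eq_one_iff_adj.1 h1
      exact .inl (hG.eq_of_adj_of_dist_lt hw'.symm hadj hd' (by omega))
    · exact .inr (by omega)

/-- The graph obtained from `G` by detaching `u` from `v` and attaching it to `w`. -/
def reattach (G : SimpleGraph V) (u v w : V) : SimpleGraph V :=
  G.deleteEdges {s(u, v)} ⊔ edge u w

section Reattach

variable {u v w : V}

lemma reattach_adj (huw : u ≠ w) {x y : V} :
    (G.reattach u v w).Adj x y ↔ (G.Adj x y ∧ s(x, y) ≠ s(u, v)) ∨ s(x, y) = s(u, w) := by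
  simp only [reattach, sup_adj, deleteEdges_adj, Set.mem_singleton_iff, edge_adj, Sym2.eq_iff, Ne]
  constructor
  · tauto
  · rintro (h | h)
    · tauto
    · refine .inr ⟨by tauto, ?_⟩
      rintro rfl
      rcases h with ⟨h1, h2⟩ | ⟨h1, h2⟩ <;> exact huw (by rw [← h1, ← h2])

variable [Fintype V] [DecidableRel G.Adj]

lemma edgeFinset_reattach [DecidableEq V] [Fintype (G.reattach u v w).edgeSet] (huw : u ≠ w) :
    (G.reattach u v w).edgeFinset = insert s(u, w) (G.edgeFinset.erase s(u, v)) := by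
  ext e
  induction e with | _ x y
  simp only [mem_edgeFinset, mem_edgeSet, reattach_adj huw, Finset.mem_insert, Finset.mem_erase]
  tauto

lemma IsTree.reattach (hG : G.IsTree) (huv : G.Adj u v) (hu : G.degree u = 1) (huw : u ≠ w)
    (hadj : ¬ G.Adj u w) : (G.reattach u v w).IsTree := by
  classical
  rw [isTree_iff_connected_and_card]
  constructor
  · have hconn := hG.connected.induce_compl_singleton_of_degree_eq_one hu
    let f : G.induce {u}ᶜ →g G.reattach u v w :=
      { toFun := Subtype.val
        map_rel' := by
          rintro ⟨x, hx⟩ ⟨y, hy⟩ hxy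
          have hx' : x ≠ u := by simpa using hx
          have hy' : y ≠ u := by simpa using hy
          rw [reattach_adj huw]
          refine .inl ⟨by simpa using hxy, ?_⟩
          rw [Ne, Sym2.eq_iff]
          tauto }
    have hreach : ∀ x, (G.reattach u v w).Reachable x w := by
      intro x
      by_cases hx : x = u
      · subst hx
        exact ((reattach_adj huw).2 (.inr rfl)).reachable
      · exact (hconn.preconnected ⟨x, by simpa using hx⟩ ⟨w, by simpa using huw.symm⟩).map f
    exact (connected_iff _).2 ⟨fun x y => (hreach x).trans (hreach y).symm, ⟨w⟩⟩
  · rw [Nat.card_eq_fintype_card, Nat.card_eq_fintype_card, ← edgeFinset_card,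
      edgeFinset_reattach huw, Finset.card_insert_of_notMem (by simp [hadj]),
      Finset.card_erase_of_mem (by simpa using huv), ← hG.card_edgeFinset]
    have : 0 < G.edgeFinset.card := Finset.card_pos.2 ⟨s(u, v), by simpa using huv⟩
    omega

variable [DecidableRel (G.reattach u v w).Adj]

lemma degree_reattach_of_ne (huw : u ≠ w) {x : V} (hxu : x ≠ u) (hxv : x ≠ v)
    (hxw : x ≠ w) : (G.reattach u v w).degree x = G.degree x := by
  rw [← card_neighborFinset_eq_degree, ← card_neighborFinset_eq_degree]
  congr 1
  ext y
  simp only [mem_neighborFinset, reattach_adj huw, Sym2.eq_iff, Ne]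
  tauto

lemma degree_reattach_leaf (huw : u ≠ w) (huv : G.Adj u v) (hu : G.degree u = 1) :
    (G.reattach u v w).degree u = 1 := by
  have hu' : ∀ y, G.Adj u y → y = v := fun y hy =>
    (degree_eq_one_iff_existsUnique_adj.1 hu).unique hy huv
  refine degree_eq_one_iff_existsUnique_adj.2 ⟨w, (reattach_adj huw).2 (.inr rfl), ?_⟩
  intro y hy
  rw [reattach_adj huw] at hy
  simp only [Sym2.eq_iff] at hy
  grind

lemma degree_reattach_old (huw : u ≠ w) (huv : G.Adj u v) (hvw : v ≠ w) :
    (G.reattach u v w).degree v = G.degree v - 1 := by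
  classical
  rw [← card_neighborFinset_eq_degree, ← card_neighborFinset_eq_degree,
    ← Finset.card_erase_of_mem (by simpa using huv.symm : u ∈ G.neighborFinset v)]
  congr 1
  ext y
  have := huv.ne
  simp only [mem_neighborFinset, reattach_adj huw, Sym2.eq_iff, Finset.mem_erase]
  grind

lemma degree_reattach_new (huw : u ≠ w) (hadj : ¬ G.Adj u w) (hvw : v ≠ w) :
    (G.reattach u v w).degree w = G.degree w + 1 := by
  classical
  rw [← card_neighborFinset_eq_degree, ← card_neighborFinset_eq_degree,
    ← Finset.card_insert_of_notMem (by simpa [adj_comm] using hadj : u ∉ G.neighborFinset w)]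
  congr 1
  ext y
  simp only [mem_neighborFinset, reattach_adj huw, Sym2.eq_iff, Finset.mem_insert]
  grind

/-- Moving a leaf `u` from `v` to another leaf `w` bounds the change of a degree-based edge sum
whose weight `F a b` grows by at least `2 * a + 1` when `a` grows by one. -/
lemma sum_edgeFinset_reattach_le [DecidableEq V] (F : ℕ → ℕ → ℕ) (hF : ∀ a b, F a b = F b a)
    (hstep : ∀ a b, 1 ≤ b → F a b + (2 * a + 1) ≤ F (a + 1) b) {w' : V}
    (huv : G.Adj u v) (hu : G.degree u = 1) (hww' : G.Adj w w') (hw : G.degree w = 1)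
    (huw : u ≠ w) (hvw : v ≠ w) :
    ∑ e ∈ (G.reattach u v w).edgeFinset, Sym2.lift ⟨fun x y =>
        F ((G.reattach u v w).degree x) ((G.reattach u v w).degree y), fun _ _ => hF _ _⟩ e
      + F 1 (G.degree v) + F 1 (G.degree w')
      + (((G.neighborFinset v).erase u).erase w).card * (2 * (G.degree v - 1) + 1) ≤
    ∑ e ∈ G.edgeFinset, Sym2.lift ⟨fun x y => F (G.degree x) (G.degree y), fun _ _ => hF _ _⟩ e
      + F 1 2 + F 2 ((G.reattach u v w).degree w') := by
  have hu' : ∀ y, G.Adj u y → y = v := fun y hy =>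
    (degree_eq_one_iff_existsUnique_adj.1 hu).unique hy huv
  have hw' : ∀ y, G.Adj w y → y = w' := fun y hy =>
    (degree_eq_one_iff_existsUnique_adj.1 hw).unique hy hww'
  have hadj : ¬ G.Adj u w := fun h => hvw (hu' w h).symm
  have hne : s(w, w') ≠ s(u, v) := by
    rw [Ne, Sym2.eq_iff]
    tauto
  have hd : 0 < G.degree v := (G.degree_pos_iff_exists_adj v).2 ⟨u, huv.symm⟩
  have hdu : (G.reattach u v w).degree u = 1 := degree_reattach_leaf huw huv hu
  have hdv : (G.reattach u v w).degree v = G.degree v - 1 := degree_reattach_old huw huv hvw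
  have hdw : (G.reattach u v w).degree w = 2 := by rw [degree_reattach_new huw hadj hvw, hw]
  have hdx : ∀ x, x ≠ u → x ≠ v → x ≠ w → (G.reattach u v w).degree x = G.degree x :=
    fun x => degree_reattach_of_ne huw
  set g : Sym2 V → ℕ :=
    Sym2.lift ⟨fun x y => F (G.degree x) (G.degree y), fun _ _ => hF _ _⟩ with hg
  set g' : Sym2 V → ℕ := Sym2.lift ⟨fun x y =>
    F ((G.reattach u v w).degree x) ((G.reattach u v w).degree y), fun _ _ => hF _ _⟩ with hg'
  set E := (G.edgeFinset.erase s(u, v)).erase s(w, w') with hE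
  have hsum : ∑ e ∈ G.edgeFinset, g e = F 1 (G.degree v) + F 1 (G.degree w') + ∑ e ∈ E, g e := by
    rw [← Finset.add_sum_erase _ g (by simpa using huv : s(u, v) ∈ G.edgeFinset),
      ← Finset.add_sum_erase _ g
        (by simpa [hne] using hww' : s(w, w') ∈ G.edgeFinset.erase s(u, v))]
    simp only [hg, Sym2.lift_mk, hu, hw]
    ring
  have hsum' : ∑ e ∈ (G.reattach u v w).edgeFinset, g' e =
      F 1 2 + F 2 ((G.reattach u v w).degree w') + ∑ e ∈ E, g' e := by
    rw [edgeFinset_reattach huw, Finset.sum_insert (by simp [hadj]),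
      ← Finset.add_sum_erase _ g'
        (by simpa [hne] using hww' : s(w, w') ∈ G.edgeFinset.erase s(u, v))]
    simp only [hg', Sym2.lift_mk, hdu, hdw]
    ring
  have hrest : ∑ e ∈ E, g' e +
      (((G.neighborFinset v).erase u).erase w).card * (2 * (G.degree v - 1) + 1) ≤
      ∑ e ∈ E, g e := by
    have hcard : (((G.neighborFinset v).erase u).erase w).card ≤ (E.filter (v ∈ ·)).card := by
      refine Finset.card_le_card_of_injOn (fun y => s(v, y)) ?_ ?_
      · intro y hy
        have := huv.ne
        simp only [Finset.coe_erase, Set.mem_sdiff, Set.mem_singleton_iff,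
          Finset.mem_coe, mem_neighborFinset] at hy
        simp only [hE, Finset.coe_filter, Finset.mem_erase, mem_edgeFinset, mem_edgeSet,
          Set.mem_ofPred_eq, Sym2.mem_iff, Ne, Sym2.eq_iff]
        tauto
      · exact fun a _ b _ hab => Sym2.congr_right.1 hab
    have hpt : ∀ e ∈ E, g' e + (if v ∈ e then 2 * (G.degree v - 1) + 1 else 0) ≤ g e := by
      intro e he
      induction e with | _ x y
      simp only [hE, Finset.mem_erase, mem_edgeFinset, mem_edgeSet] at he
      obtain ⟨h1, h2, hxy⟩ := he
      have hxu : x ≠ u := by rintro rfl; exact h2 (by rw [hu' y hxy])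
      have hyu : y ≠ u := by rintro rfl; exact h2 (by rw [hu' x hxy.symm, Sym2.eq_swap])
      have hxw : x ≠ w := by rintro rfl; exact h1 (by rw [hw' y hxy])
      have hyw : y ≠ w := by rintro rfl; exact h1 (by rw [hw' x hxy.symm, Sym2.eq_swap])
      have hend : ∀ z, G.Adj v z → z ≠ u → z ≠ w →
          F ((G.reattach u v w).degree v) ((G.reattach u v w).degree z)
            + (2 * (G.degree v - 1) + 1) ≤ F (G.degree v) (G.degree z) := by
        intro z hz hzu hzw
        rw [hdv, hdx z hzu hz.ne' hzw]
        have := hstep (G.degree v - 1) (G.degree z)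
          ((G.degree_pos_iff_exists_adj z).2 ⟨v, hz.symm⟩)
        rwa [Nat.sub_add_cancel hd] at this
      simp only [hg, hg', Sym2.lift_mk, Sym2.mem_iff]
      by_cases hxv : x = v
      · subst hxv
        simpa using hend y hxy hyu hyw
      · by_cases hyv : y = v
        · subst hyv
          rw [hF _ ((G.reattach u y w).degree y), hF (G.degree x)]
          simpa using hend x hxy.symm hxu hxw
        · rw [if_neg (by tauto), hdx x hxu hxv hxw, hdx y hyu hyv hyw, add_zero]
    have := Finset.sum_le_sum hpt
    rw [Finset.sum_add_distrib, ← Finset.sum_filter, Finset.sum_const, smul_eq_mul] at this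
    exact le_trans (Nat.add_le_add_left (Nat.mul_le_mul_right _ hcard) _) this
  omega

end Reattach

end SimpleGraph

theorem stmt4 (n Δ : ℕ) (T : SimpleGraph (Fin n)) (hT : T.IsTree) (hΔ : maxDeg T = Δ)
    (ρ : Fin n) (hρ : deg T ρ = Δ)
    (v : Fin n) (hvρ : v ≠ ρ) (hv : IsSupportVertex T v) (hv3 : 3 ≤ deg T v) :
    ∃ T' : SimpleGraph (Fin n), T'.IsTree ∧ maxDeg T' = Δ ∧
      HM1 T' < HM1 T ∧ HM2 T' < HM2 T := by
  classical
  obtain ⟨v, hvS, hmax⟩ := Finset.exists_max_image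
    (Finset.univ.filter fun v => v ≠ ρ ∧ IsSupportVertex T v ∧ 3 ≤ deg T v)
    (T.dist ρ) ⟨v, by simp [hvρ, hv, hv3]⟩
  obtain ⟨hvρ, ⟨u, huv, hu⟩, hv3⟩ := (Finset.mem_filter.1 hvS).2
  change T.degree u = 1 at hu
  change 3 ≤ T.degree v at hv3
  change T.degree ρ = Δ at hρ
  have hle : ∀ x, T.degree x ≤ Δ := fun x => (T.degree_le_maxDegree x).trans hΔ.le
  obtain ⟨w, w', hwu, hww', hw, hw'⟩ := hT.exists_leaf_beyond ρ huv hu hv3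
  have hvw : v ≠ w := by rintro rfl; omega
  have hw'v : w' = v ∨ (w' ≠ v ∧ T.degree w' ≤ 2) := by
    refine hw'.imp_right fun h => ⟨by rintro rfl; omega, ?_⟩
    by_contra! hlt
    refine h.not_ge (hmax w' ?_)
    have : w' ≠ ρ := by rintro rfl; simp at h
    exact Finset.mem_filter.2 ⟨Finset.mem_univ _, this, ⟨w, hww'.symm, hw⟩, hlt⟩
  have hu' : ∀ y, T.Adj u y → y = v := fun y hy =>
    (SimpleGraph.degree_eq_one_iff_existsUnique_adj.1 hu).unique hy huv.symm
  have hadj : ¬ T.Adj u w := fun h => hvw (hu' w h).symm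
  have hΔ3 : 3 ≤ Δ := hv3.trans (hle v)
  have hρu : ρ ≠ u := by rintro rfl; omega
  have hρw : ρ ≠ w := by rintro rfl; omega
  have hdu := SimpleGraph.degree_reattach_leaf hwu.symm huv.symm hu
  have hdv := SimpleGraph.degree_reattach_old hwu.symm huv.symm hvw
  have hdw := SimpleGraph.degree_reattach_new hwu.symm hadj hvw
  refine ⟨T.reattach u v w, hT.reattach huv.symm hu hwu.symm hadj, ?_, ?_⟩
  · change (T.reattach u v w).maxDegree = Δ
    apply le_antisymm
    · refine SimpleGraph.maxDegree_le_of_forall_degree_le _ _ fun x => ?_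
      have := hle v
      by_cases hxu : x = u
      · subst hxu; omega
      by_cases hxv : x = v
      · subst hxv; omega
      by_cases hxw : x = w
      · subst hxw; omega
      rw [SimpleGraph.degree_reattach_of_ne hwu.symm hxu hxv hxw]
      exact hle x
    · rw [← hρ, ← SimpleGraph.degree_reattach_of_ne (v := v) hwu.symm hρu hvρ.symm hρw]
      exact SimpleGraph.degree_le_maxDegree _ _
  have h1 := SimpleGraph.sum_edgeFinset_reattach_le (fun a b => (a + b) ^ 2)
    (fun a b => by ring) (fun a b _ => by nlinarith) huv.symm hu hww' hw hwu.symm hvw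
  have h2 := SimpleGraph.sum_edgeFinset_reattach_le (fun a b => (a * b) ^ 2)
    (fun a b => by ring) (fun a b hb => by
      have : 1 ≤ b ^ 2 := Nat.one_le_pow _ _ hb
      nlinarith [Nat.mul_le_mul_left (2 * a + 1) this]) huv.symm hu hww' hw hwu.symm hvw
  change HM1 (T.reattach u v w) + _ + _ + _ ≤ HM1 T + _ + _ at h1
  change HM2 (T.reattach u v w) + _ + _ + _ ≤ HM2 T + _ + _ at h2
  have hcard : ((T.neighborFinset v).erase u).card = T.degree v - 1 := by
    rw [Finset.card_erase_of_mem (by simpa using huv), SimpleGraph.card_neighborFinset_eq_degree]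
  obtain ⟨d, hd⟩ : ∃ d, T.degree v = d + 3 := ⟨T.degree v - 3, by omega⟩
  rw [hd] at h1 h2 hcard hdv
  simp only [Nat.add_succ_sub_one] at h1 h2 hcard hdv
  rcases hw'v with rfl | ⟨hne, hle2⟩
  · have hk : (((T.neighborFinset w').erase u).erase w).card = d + 1 := by
      rw [Finset.card_erase_of_mem (by simpa [hwu] using hww'.symm), hcard]
      rfl
    rw [hk, hdv, hd] at h1 h2
    constructor <;> linarith [Nat.zero_le (d ^ 2)]
  · have hk : (((T.neighborFinset v).erase u).erase w).card = d + 2 := by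
      rw [Finset.erase_eq_of_notMem, hcard]
      simp only [Finset.mem_erase, SimpleGraph.mem_neighborFinset, not_and]
      intro _ h
      exact hne ((SimpleGraph.degree_eq_one_iff_existsUnique_adj.1 hw).unique hww' h.symm)
    have hw'u : w' ≠ u := by rintro rfl; exact hadj hww'.symm
    rw [hk, SimpleGraph.degree_reattach_of_ne hwu.symm hw'u hne hww'.ne'] at h1 h2
    generalize T.degree w' = x at h1 h2 hle2
    constructor <;> interval_cases x <;> linarith [Nat.zero_le (d ^ 2)]
end

section
/- Let T be a tree with n vertices and maximum degree Δ containing a vertex ρ with deg(ρ) = Δ. If T has a vertex distinct from ρ whose degree is at least 3, then there exists a tree T' with n vertices and maximum degree Δ such that e^{HM₁(T)} > e^{HM₁(T')} and e^{HM₂(T)} > e^{HM₂(T')}. -/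
namespace SimpleGraph

section Rooted

variable {V : Type*} {G : SimpleGraph V}

/-- A vertex other than the root has a neighbour that is closer to the root. -/
lemma Connected.exists_adj_dist_add_one_eq (hG : G.Connected) {r x : V} (hx : x ≠ r) :
    ∃ y, G.Adj x y ∧ G.dist r y + 1 = G.dist r x := by
  obtain ⟨p, hp⟩ := hG.exists_walk_length_eq_dist x r
  cases p with
  | nil => exact absurd rfl hx
  | @cons _ y _ h q =>
    refine ⟨y, h, ?_⟩
    have h₁ : G.dist y r ≤ q.length := dist_le q
    have h₂ : G.dist x r ≤ G.dist x y + G.dist y r := hG.dist_triangle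
    have h₃ : G.dist x y = 1 := dist_eq_one_iff_adj.mpr h
    rw [Walk.length_cons] at hp
    rw [dist_comm (u := r) (v := y), dist_comm (u := r) (v := x)]
    omega

/-- In a tree, the neighbour of a vertex that is closer to the root is unique. -/
lemma IsTree.eq_of_adj_of_dist_lt_s5 (hG : G.IsTree) {r x y z : V} (hy : G.Adj x y) (hz : G.Adj x z)
    (hyx : G.dist r y < G.dist r x) (hzx : G.dist r z < G.dist r x) : y = z := by
  classical
  have key : ∀ u, G.Adj x u → G.dist r u < G.dist r x →
      ∃ p : G.Walk r x, p.IsPath ∧ p.penultimate = u := by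
    intro u hu hux
    obtain ⟨p, hp, hlen⟩ := hG.connected.exists_path_of_dist r u
    refine ⟨p.concat hu.symm, hp.concat (fun hmem ↦ ?_) hu.symm, by simp⟩
    have h₁ := dist_le (p.takeUntil x hmem)
    have h₂ := p.length_takeUntil_le_length hmem
    omega
  obtain ⟨p, hp, rfl⟩ := key y hy hyx
  obtain ⟨q, hq, rfl⟩ := key z hz hzx
  rw [(hG.existsUnique_path r x).unique hp hq]

end Rooted

section MoveEdge

variable {V : Type*}

/-- Replace the edge `va` of `G` by the edge `aw`. -/
def moveEdge (G : SimpleGraph V) (v a w : V) : SimpleGraph V :=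
  G.deleteEdges {s(v, a)} ⊔ edge a w

variable {G : SimpleGraph V} {v a w : V}

lemma edgeSet_moveEdge (haw : a ≠ w) :
    (G.moveEdge v a w).edgeSet = insert s(a, w) (G.edgeSet \ {s(v, a)}) := by
  rw [moveEdge, edgeSet_sup, edgeSet_deleteEdges, edgeSet_edge_of_ne haw, Set.union_singleton]

lemma IsTree.moveEdge [Finite V] (hG : G.IsTree) (hva : G.Adj v a) (haw : a ≠ w)
    (hnaw : ¬ G.Adj a w) (hreach : (G.deleteEdges {s(v, a)}).Reachable v w) :
    (G.moveEdge v a w).IsTree := by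
  rw [isTree_iff_connected_and_card] at hG ⊢
  obtain ⟨hconn, hcard⟩ := hG
  have hreach' : (G.moveEdge v a w).Reachable v a :=
    (hreach.mono le_sup_left).trans
      (Adj.reachable (Or.inr (by simp [edge_adj, haw.symm])))
  have := hconn.nonempty
  refine ⟨⟨fun x y ↦ ?_⟩, ?_⟩
  · obtain ⟨p⟩ := hconn x y
    induction p with
    | nil => rfl
    | @cons x z _ h _ ih =>
      refine Reachable.trans ?_ ih
      by_cases he : s(x, z) = s(v, a)
      · rcases Sym2.eq_iff.mp he with ⟨rfl, rfl⟩ | ⟨rfl, rfl⟩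
        · exact hreach'
        · exact hreach'.symm
      · exact Adj.reachable (Or.inl (by simpa [deleteEdges_adj, h] using he))
  · rw [edgeSet_moveEdge haw, ← hcard, Nat.card_coe_set_eq, Nat.card_coe_set_eq]
    rw [Set.ncard_exchange (by simpa using hnaw) (by simpa using hva)]

end MoveEdge

end SimpleGraph

open SimpleGraph

/-- In a tree with a branching vertex other than the root `r`, let `v` be such a vertex farthest
from `r`, `a` its parent, `w` a deepest descendant of `v` and `u` the neighbour of `w`. -/
lemma exists_branching_vertex_and_leaf {V : Type*} [Fintype V] {T : SimpleGraph V} (hT : T.IsTree) {r v₀ : V}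
    (hv₀ : v₀ ≠ r) (hdeg : 3 ≤ deg T v₀) :
    ∃ v a w u, v ≠ r ∧ 3 ≤ deg T v ∧ T.Adj v a ∧ a ≠ w ∧ ¬ T.Adj a w ∧
      (T.deleteEdges {s(v, a)}).Reachable v w ∧ w ≠ v ∧ deg T w = 1 ∧ T.Adj w u ∧
      (u = v ∨ deg T u ≤ 2) := by
  classical
  obtain ⟨v, hv, hvmax⟩ := (Finset.univ.filter fun x ↦ x ≠ r ∧ 3 ≤ deg T x).exists_max_image
    (T.dist r) ⟨v₀, by simp [hv₀, hdeg]⟩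
  simp only [Finset.mem_filter, Finset.mem_univ, true_and] at hv hvmax
  obtain ⟨w, hw, hwmax⟩ := (Finset.univ.filter fun x ↦
    T.dist r x = T.dist r v + T.dist v x).exists_max_image (T.dist r) ⟨v, by simp⟩
  simp only [Finset.mem_filter, Finset.mem_univ, true_and] at hw hwmax
  have hstep : ∀ {x y}, T.Adj x y → ∀ t,
      T.dist t x = T.dist t y + 1 ∨ T.dist t y = T.dist t x + 1 :=
    fun h t ↦ hT.dist_eq_dist_add_one_of_adj t h
  have hlower : ∀ x, T.Adj w x → T.dist r x < T.dist r w := by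
    intro x hx
    by_contra hlt
    have h₁ := hstep hx r
    have h₂ := hstep hx v
    have h₃ : T.dist r x ≤ T.dist r v + T.dist v x := hT.connected.dist_triangle
    have := hwmax x (by omega)
    omega
  have hdegw : deg T w ≤ 1 := by
    change (T.neighborFinset w).card ≤ 1
    rw [Finset.card_le_one]
    intro x hx y hy
    rw [mem_neighborFinset] at hx hy
    exact hT.eq_of_adj_of_dist_lt_s5 hx hy (hlower x hx) (hlower y hy)
  have hwv : w ≠ v := by
    rintro rfl
    omega
  obtain ⟨a, hva, ha⟩ := hT.connected.exists_adj_dist_add_one_eq hv.1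
  obtain ⟨u, hwu, hu⟩ := hT.connected.exists_adj_dist_add_one_eq hwv
  have hpos := hT.connected.pos_dist_of_ne hwv.symm
  have haw : a ≠ w := by
    rintro rfl
    omega
  refine ⟨v, a, w, u, hv.1, hv.2, hva, haw, fun h ↦ ?_, ?_, hwv, ?_, hwu, ?_⟩
  · have := hstep h r
    omega
  · obtain ⟨p, hp⟩ := hT.connected.exists_walk_length_eq_dist v w
    refine ⟨p.toDeleteEdge s(v, a) fun hmem ↦ ?_⟩
    have hsupp := p.snd_mem_support_of_mem_edges hmem
    have hlen := congrArg Walk.length (p.take_spec hsupp)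
    rw [Walk.length_append] at hlen
    have h₁ := dist_le (p.takeUntil a hsupp)
    have h₂ := dist_le (p.dropUntil a hsupp)
    have h₃ : T.dist r w ≤ T.dist r a + T.dist a w := hT.connected.dist_triangle
    omega
  · have : 0 < deg T w := by
      change 0 < T.degree w
      exact (T.degree_pos_iff_exists_adj w).mpr ⟨u, hwu⟩
    omega
  · by_contra! hcon
    have h₁ := hlower u hwu
    have h₂ := hstep hwu r
    have h₃ : 0 < T.dist v u := hT.connected.pos_dist_of_ne hcon.1.symm
    have := hvmax u ⟨?_, hcon.2⟩
    · omega
    · rintro rfl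
      rw [dist_self] at h₂
      omega

/-- The sum of `g (deg u) (deg v)` over the edges `uv` of `G`. -/
noncomputable def degreeEdgeSum {V : Type*} [Fintype V] (G : SimpleGraph V) (g : ℕ → ℕ → ℕ)
    (hg : ∀ x y, g x y = g y x) : ℕ := by
  classical
  exact ∑ e ∈ G.edgeFinset,
    Sym2.lift ⟨fun u v => g (G.degree u) (G.degree v), fun _ _ => hg _ _⟩ e

section Counting

variable {V : Type*} [Fintype V] {G : SimpleGraph V} {v a w u : V}

open Classical in
lemma deg_eq_sum (G : SimpleGraph V) (x : V) :
    deg G x = ∑ e ∈ G.edgeFinset, if x ∈ e then 1 else 0 := by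
  rw [← Finset.card_filter, ← incidenceFinset_eq_filter, card_incidenceFinset_eq_degree]
  rfl

open Classical in
lemma edgeFinset_moveEdge (haw : a ≠ w) :
    (G.moveEdge v a w).edgeFinset = insert s(a, w) (G.edgeFinset.erase s(v, a)) := by
  rw [← Finset.coe_inj]
  simp [edgeSet_moveEdge haw]

open Classical in
lemma deg_moveEdge_add (hva : G.Adj v a) (haw : a ≠ w) (hnaw : ¬ G.Adj a w) (x : V) :
    deg (G.moveEdge v a w) x + (if x ∈ s(v, a) then 1 else 0) =
      deg G x + if x ∈ s(a, w) then 1 else 0 := by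
  rw [deg_eq_sum, deg_eq_sum, edgeFinset_moveEdge haw, Finset.sum_insert (by simp [hnaw]),
    ← Finset.add_sum_erase G.edgeFinset _ (mem_edgeFinset.mpr (G.mem_edgeSet.mpr hva))]
  omega

lemma deg_moveEdge_source (hva : G.Adj v a) (haw : a ≠ w) (hnaw : ¬ G.Adj a w) (hwv : w ≠ v) :
    deg (G.moveEdge v a w) v + 1 = deg G v := by
  have := deg_moveEdge_add hva haw hnaw v
  simpa [hva.ne, hwv.symm] using this

lemma deg_moveEdge_target (hva : G.Adj v a) (haw : a ≠ w) (hnaw : ¬ G.Adj a w) (hwv : w ≠ v) :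
    deg (G.moveEdge v a w) w = deg G w + 1 := by
  have := deg_moveEdge_add hva haw hnaw w
  simpa [haw.symm, hwv] using this

lemma deg_moveEdge_of_ne (hva : G.Adj v a) (haw : a ≠ w) (hnaw : ¬ G.Adj a w) {x : V}
    (hxv : x ≠ v) (hxw : x ≠ w) : deg (G.moveEdge v a w) x = deg G x := by
  have := deg_moveEdge_add hva haw hnaw x
  by_cases hxa : x = a <;> simpa [hxv, hxw, hxa] using this

lemma eq_of_adj_of_deg_eq_one (hw : deg G w = 1) (hwu : G.Adj w u) {x : V} (hx : G.Adj w x) :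
    x = u := by
  classical
  have h : (G.neighborFinset w).card ≤ 1 := hw.le
  exact Finset.card_le_one.mp h x (by simpa using hx) u (by simpa using hwu)

lemma one_le_deg_of_adj {x y : V} (h : G.Adj x y) : 1 ≤ deg G x := by
  classical
  exact (G.degree_pos_iff_exists_adj x).mpr ⟨y, h⟩

open Classical in
/-- Moving the edge `va` to a leaf `w`: apart from the edge `va` and the edge at `w`, every edge
at `v` loses at least `c`, and the other edges are unaffected. -/
lemma degreeEdgeSum_moveEdge_add_le (g : ℕ → ℕ → ℕ) (hg : ∀ x y, g x y = g y x) (c : ℕ)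
    (hva : G.Adj v a) (haw : a ≠ w) (hnaw : ¬ G.Adj a w) (hwv : w ≠ v) (hw : deg G w = 1)
    (hwu : G.Adj w u) (hc : ∀ z, 1 ≤ z → g (deg G v - 1) z + c ≤ g (deg G v) z) :
    ∃ k, k + 1 + (if u = v then 1 else 0) = deg G v ∧
      degreeEdgeSum (G.moveEdge v a w) g hg + c * k + g 1 (deg G u) + g (deg G v) (deg G a) ≤
        degreeEdgeSum G g hg + g 2 (deg (G.moveEdge v a w) u) + g 2 (deg G a) := by
  set G' := G.moveEdge v a w with hG'
  have hdv := deg_moveEdge_source hva haw hnaw hwv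
  have hdw := deg_moveEdge_target hva haw hnaw hwv
  have hda := deg_moveEdge_of_ne hva haw hnaw hva.ne' haw
  rw [← hG'] at hdv hdw hda
  have hne : s(w, u) ≠ s(v, a) := by simp [hwv, haw.symm]
  have hmem : s(w, u) ∈ G.edgeFinset.erase s(v, a) := by simp [hne, hwu]
  set E := (G.edgeFinset.erase s(v, a)).erase s(w, u) with hE
  let f' : Sym2 V → ℕ := Sym2.lift ⟨fun x y => g (deg G' x) (deg G' y), fun _ _ => hg _ _⟩
  let f : Sym2 V → ℕ := Sym2.lift ⟨fun x y => g (deg G x) (deg G y), fun _ _ => hg _ _⟩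
  have hsum' : degreeEdgeSum G' g hg = f' s(a, w) + (f' s(w, u) + ∑ e ∈ E, f' e) := by
    change ∑ e ∈ G'.edgeFinset, f' e = _
    rw [edgeFinset_moveEdge haw, Finset.sum_insert (by simp [hnaw]), Finset.add_sum_erase _ _ hmem]
  have hsum : degreeEdgeSum G g hg = f s(v, a) + (f s(w, u) + ∑ e ∈ E, f e) := by
    change ∑ e ∈ G.edgeFinset, f e = _
    rw [Finset.add_sum_erase _ _ hmem,
      Finset.add_sum_erase _ _ (mem_edgeFinset.mpr (G.mem_edgeSet.mpr hva))]
  have hle : ∑ e ∈ E, (f' e + c * if v ∈ e then 1 else 0) ≤ ∑ e ∈ E, f e := by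
    refine Finset.sum_le_sum fun e he ↦ ?_
    induction e with | h x y =>
    simp only [hE, Finset.mem_erase, mem_edgeFinset, mem_edgeSet] at he
    obtain ⟨hxy, -, hadj⟩ := he
    have hxw : x ≠ w := by
      rintro rfl
      exact hxy (by rw [eq_of_adj_of_deg_eq_one hw hwu hadj])
    have hyw : y ≠ w := by
      rintro rfl
      exact hxy (by rw [eq_of_adj_of_deg_eq_one hw hwu hadj.symm, Sym2.eq_swap])
    have hdv' : deg G' v = deg G v - 1 := by omega
    change g (deg G' x) (deg G' y) + _ ≤ g (deg G x) (deg G y)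
    by_cases hxv : x = v
    · subst hxv
      rw [deg_moveEdge_of_ne hva haw hnaw hadj.ne' hyw, hdv']
      simpa using hc _ (one_le_deg_of_adj hadj.symm)
    · rw [deg_moveEdge_of_ne hva haw hnaw hxv hxw]
      by_cases hyv : y = v
      · subst hyv
        rw [hdv', hg, hg (deg G x)]
        simpa using hc _ (one_le_deg_of_adj hadj)
      · rw [deg_moveEdge_of_ne hva haw hnaw hyv hyw]
        simp [Ne.symm hxv, Ne.symm hyv]
  rw [Finset.sum_add_distrib, ← Finset.mul_sum] at hle
  refine ⟨∑ e ∈ E, if v ∈ e then 1 else 0, ?_, ?_⟩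
  · rw [deg_eq_sum, ← Finset.add_sum_erase _ _ (mem_edgeFinset.mpr (G.mem_edgeSet.mpr hva)),
      ← Finset.add_sum_erase _ _ hmem, ← hE]
    simp only [Sym2.mem_iff, hwv.symm, true_or, false_or, if_true, eq_comm (a := v) (b := u)]
    omega
  · have h₁ : f' s(a, w) = g 2 (deg G a) := by
      change g (deg G' a) (deg G' w) = _
      rw [hda, hdw, hw, hg]
    have h₂ : f' s(w, u) = g 2 (deg G' u) := by
      change g (deg G' w) (deg G' u) = _
      rw [hdw, hw]
    have h₃ : f s(w, u) = g 1 (deg G u) := by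
      change g (deg G w) (deg G u) = _
      rw [hw]
    have h₄ : f s(v, a) = g (deg G v) (deg G a) := rfl
    omega

lemma maxDeg_moveEdge {r : V} (hr : deg G r = maxDeg G) (hva : G.Adj v a) (haw : a ≠ w)
    (hnaw : ¬ G.Adj a w) (hwv : w ≠ v) (hw : deg G w = 1) (hvr : v ≠ r) (hv : 3 ≤ deg G v) :
    maxDeg (G.moveEdge v a w) = maxDeg G := by
  classical
  have hle : ∀ (H : SimpleGraph V) x, deg H x ≤ maxDeg H := fun H x ↦ H.degree_le_maxDegree x
  apply le_antisymm
  · refine maxDegree_le_of_forall_degree_le _ _ fun x ↦ ?_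
    change deg _ x ≤ _
    have hx := hle G x
    have hv' := hle G v
    by_cases hxv : x = v
    · have := deg_moveEdge_source hva haw hnaw hwv
      subst hxv
      omega
    by_cases hxw : x = w
    · rw [hxw, deg_moveEdge_target hva haw hnaw hwv]
      omega
    · rwa [deg_moveEdge_of_ne hva haw hnaw hxv hxw]
  · have hrw : r ≠ w := by
      rintro rfl
      have := hle G v
      omega
    rw [← hr, ← deg_moveEdge_of_ne hva haw hnaw hvr.symm hrw]
    exact hle _ r

end Counting

lemma HM1_eq_degreeEdgeSum {V : Type*} [Fintype V] (G : SimpleGraph V) :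
    HM1 G = degreeEdgeSum G (fun x y ↦ (x + y) ^ 2) (fun x y ↦ by ring) := rfl

lemma HM2_eq_degreeEdgeSum {V : Type*} [Fintype V] (G : SimpleGraph V) :
    HM2 G = degreeEdgeSum G (fun x y ↦ (x * y) ^ 2) (fun x y ↦ by ring) := rfl

section Decrease

variable {V : Type*} [Fintype V] {G : SimpleGraph V} {v a w u : V}

lemma HM1_moveEdge_lt (hva : G.Adj v a) (haw : a ≠ w) (hnaw : ¬ G.Adj a w) (hwv : w ≠ v)
    (hw : deg G w = 1) (hwu : G.Adj w u) (hv : 3 ≤ deg G v) (hu : u = v ∨ deg G u ≤ 2) :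
    HM1 (G.moveEdge v a w) < HM1 G := by
  obtain ⟨d, hd⟩ : ∃ d, deg G v = d + 3 := ⟨deg G v - 3, by omega⟩
  obtain ⟨k, hk, hle⟩ := degreeEdgeSum_moveEdge_add_le (fun x y ↦ (x + y) ^ 2)
    (fun x y ↦ by ring) 1 hva haw hnaw hwv hw hwu (by
      intro z hz
      simp only [hd, Nat.add_succ_sub_one]
      nlinarith)
  rw [← HM1_eq_degreeEdgeSum, ← HM1_eq_degreeEdgeSum, hd] at hle
  have hdv := deg_moveEdge_source hva haw hnaw hwv
  have ha := one_le_deg_of_adj hva.symm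
  by_cases huv : u = v
  · subst huv
    simp only [hd, if_true] at hk
    obtain rfl : k = d + 1 := by omega
    obtain hdv' : deg (G.moveEdge u a w) u = d + 2 := by omega
    rw [hdv', hd] at hle
    nlinarith
  · simp only [hd, huv, if_false] at hk
    obtain rfl : k = d + 2 := by omega
    rw [deg_moveEdge_of_ne hva haw hnaw huv hwu.ne'] at hle
    have hu' := hu.resolve_left huv
    nlinarith

lemma HM2_moveEdge_lt (hva : G.Adj v a) (haw : a ≠ w) (hnaw : ¬ G.Adj a w) (hwv : w ≠ v)
    (hw : deg G w = 1) (hwu : G.Adj w u) (hv : 3 ≤ deg G v) (hu : u = v ∨ deg G u ≤ 2) :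
    HM2 (G.moveEdge v a w) < HM2 G := by
  obtain ⟨d, hd⟩ : ∃ d, deg G v = d + 3 := ⟨deg G v - 3, by omega⟩
  obtain ⟨k, hk, hle⟩ := degreeEdgeSum_moveEdge_add_le (fun x y ↦ (x * y) ^ 2)
    (fun x y ↦ by ring) (2 * d + 5) hva haw hnaw hwv hw hwu (by
      intro z hz
      simp only [hd, Nat.add_succ_sub_one]
      have : 1 ≤ z ^ 2 := Nat.one_le_pow _ _ hz
      nlinarith)
  rw [← HM2_eq_degreeEdgeSum, ← HM2_eq_degreeEdgeSum, hd] at hle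
  have hdv := deg_moveEdge_source hva haw hnaw hwv
  have ha : 1 ≤ deg G a ^ 2 := Nat.one_le_pow _ _ (one_le_deg_of_adj hva.symm)
  have hda : (d + 1) * (d + 5) * 1 ≤ (d + 1) * (d + 5) * deg G a ^ 2 := Nat.mul_le_mul_left _ ha
  by_cases huv : u = v
  · subst huv
    simp only [hd, if_true] at hk
    obtain rfl : k = d + 1 := by omega
    obtain hdv' : deg (G.moveEdge u a w) u = d + 2 := by omega
    rw [hdv', hd] at hle
    nlinarith
  · simp only [hd, huv, if_false] at hk
    obtain rfl : k = d + 2 := by omega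
    rw [deg_moveEdge_of_ne hva haw hnaw huv hwu.ne'] at hle
    have hu' : deg G u ^ 2 ≤ 2 ^ 2 := Nat.pow_le_pow_left (hu.resolve_left huv) 2
    nlinarith

end Decrease

theorem stmt5 (n Δ : ℕ) (T : SimpleGraph (Fin n)) (hT : T.IsTree) (hΔ : maxDeg T = Δ)
    (ρ : Fin n) (hρ : deg T ρ = Δ)
    (v : Fin n) (hvρ : v ≠ ρ) (hv3 : 3 ≤ deg T v) :
    ∃ T' : SimpleGraph (Fin n), T'.IsTree ∧ maxDeg T' = Δ ∧
      Real.exp (HM1 T') < Real.exp (HM1 T) ∧ Real.exp (HM2 T') < Real.exp (HM2 T) := by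
  obtain ⟨v, a, w, u, hvr, hv, hva, haw, hnaw, hreach, hwv, hw, hwu, hu⟩ :=
    exists_branching_vertex_and_leaf hT hvρ hv3
  refine ⟨T.moveEdge v a w, hT.moveEdge hva haw hnaw hreach, ?_, ?_, ?_⟩
  · rw [maxDeg_moveEdge (hρ.trans hΔ.symm) hva haw hnaw hwv hw hvr hv, hΔ]
  · exact Real.exp_lt_exp.mpr (Nat.cast_lt.mpr (HM1_moveEdge_lt hva haw hnaw hwv hw hwu hv hu))
  · exact Real.exp_lt_exp.mpr (Nat.cast_lt.mpr (HM2_moveEdge_lt hva haw hnaw hwv hw hwu hv hu))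
end

section
/- Let T be a tree with at least 2 vertices and bipartition (X, Y). Then the equitable chromatic number of T satisfies χ_e(T) ≤ ⌈(|X| + |Y| + 1)/(min{|X|, |Y|} + 1)⌉. -/
/-- `G` admits an equitable proper coloring with `k` colors: a proper coloring in which
the sizes of any two color classes differ by at most 1. -/
def HasEquitableColoring {V : Type*} [Fintype V] (G : SimpleGraph V) (k : ℕ) : Prop :=
  ∃ C : V → Fin k, (∀ ⦃u v⦄, G.Adj u v → C u ≠ C v) ∧
    ∀ i j : Fin k, {v | C v = i}.ncard ≤ {v | C v = j}.ncard + 1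

/-- The equitable chromatic number: the least `k` for which `G` admits an equitable
proper coloring with `k` colors. -/
noncomputable def eqChromNum {V : Type*} [Fintype V] (G : SimpleGraph V) : ℕ :=
  sInf {k | HasEquitableColoring G k}

/-- Some `L`-element subset of a finset has at most average total weight. -/
theorem exists_subset_card_mul_sum_le {α : Type*} [DecidableEq α] (X : Finset α) (f : α → ℕ)
    {L : ℕ} (hL : L ≤ X.card) :
    ∃ S ⊆ X, S.card = L ∧ X.card * ∑ x ∈ S, f x ≤ L * ∑ x ∈ X, f x := by
  induction hL using Nat.decreasingInduction with
  | self => exact ⟨X, subset_rfl, rfl, le_rfl⟩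
  | of_succ L _ ih =>
    obtain ⟨S, hSX, hS, hsum⟩ := ih
    obtain ⟨a, ha, hmax⟩ := S.exists_max_image f (Finset.card_pos.1 (by lia))
    refine ⟨S.erase a, (S.erase_subset a).trans hSX, by rw [Finset.card_erase_of_mem ha]; lia, ?_⟩
    have hle : ∑ x ∈ S, f x ≤ (L + 1) * f a := by
      simpa [hS] using Finset.sum_le_card_nsmul S f (f a) hmax
    have hadd := Finset.sum_erase_add S f ha
    refine Nat.le_of_mul_le_mul_left (c := L + 1) ?_ L.succ_pos
    have hstep : (L + 1) * ∑ x ∈ S.erase a, f x ≤ L * ∑ x ∈ S, f x := by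
      rw [← hadd] at hle ⊢
      linarith
    calc (L + 1) * (X.card * ∑ x ∈ S.erase a, f x)
        = X.card * ((L + 1) * ∑ x ∈ S.erase a, f x) := by ring
      _ ≤ X.card * (L * ∑ x ∈ S, f x) := Nat.mul_le_mul_left _ hstep
      _ = L * (X.card * ∑ x ∈ S, f x) := by ring
      _ ≤ L * ((L + 1) * ∑ x ∈ X, f x) := Nat.mul_le_mul_left _ hsum
      _ = _ := by ring

/-- A finset of size between `p * q` and `p * (q + 1)` splits into `p` parts of size `q` or
`q + 1`. -/
theorem exists_fibers_card_le {α : Type*} [DecidableEq α] (p q : ℕ) (Z : Finset α)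
    (hlo : p * q ≤ Z.card) (hhi : Z.card ≤ p * (q + 1)) :
    ∃ f : α → ℕ, (∀ z ∈ Z, f z < p) ∧
      ∀ i < p, q ≤ {z ∈ Z | f z = i}.card ∧ {z ∈ Z | f z = i}.card ≤ q + 1 := by
  induction p generalizing Z with
  | zero =>
    obtain rfl : Z = ∅ := by simpa using hhi
    exact ⟨fun _ => 0, by simp, by simp⟩
  | succ p ih =>
    obtain ⟨s, hqs, hsq, hs, h1, h2⟩ : ∃ s, q ≤ s ∧ s ≤ q + 1 ∧ s ≤ Z.card ∧
        p * q ≤ Z.card - s ∧ Z.card - s ≤ p * (q + 1) := by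
      rw [Nat.add_mul, Nat.one_mul] at hlo hhi
      by_cases h : Z.card - q ≤ p * (q + 1)
      · exact ⟨q, by lia, by lia, by lia, by lia, h⟩
      · have := Nat.mul_le_mul_left p q.le_succ
        exact ⟨q + 1, by lia, by lia, by lia, by lia, by lia⟩
    obtain ⟨S, hSZ, rfl⟩ := Finset.exists_subset_card_eq hs
    have hc := Finset.card_sdiff_of_subset hSZ
    obtain ⟨f, hf, hfib⟩ := ih (Z \ S) (by lia) (by lia)
    refine ⟨fun z => if z ∈ S then p else f z, fun z hz => ?_, fun i hi => ?_⟩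
    · by_cases hzS : z ∈ S
      · simp [hzS]
      · simpa [hzS] using (hf z (by simp [hz, hzS])).trans p.lt_succ_self
    · obtain hip | rfl := Nat.lt_succ_iff_lt_or_eq.1 hi
      · convert hfib i hip using 3 <;>
        · ext z
          have := hip.ne'
          by_cases hzS : z ∈ S <;> simp [hzS, this]
      · have : {z ∈ Z | (if z ∈ S then i else f z) = i} = S := by
          ext z
          by_cases hzS : z ∈ S
          · simp [hzS, hSZ hzS]
          · simpa [hzS] using fun hz => (hf z (by simp [hz, hzS])).ne
        simp only [this]
        exact ⟨hqs, hsq⟩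

/-- A coloring by the naturals below `k` with class sizes in `{q, q + 1}` is equitable. -/
theorem HasEquitableColoring.of_nat_coloring {V : Type*} [Fintype V] {G : SimpleGraph V}
    {k q : ℕ} (C : V → ℕ) (hC : ∀ v, C v < k) (hadj : ∀ u v, G.Adj u v → C u ≠ C v)
    (hq : ∀ i < k, q ≤ {v | C v = i}.ncard ∧ {v | C v = i}.ncard ≤ q + 1) :
    HasEquitableColoring G k := by
  refine ⟨fun v => ⟨C v, hC v⟩, fun u v huv => by simpa using hadj u v huv, fun i j => ?_⟩
  simp only [Fin.ext_iff]
  have hi := (hq i i.2).2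
  have hj := (hq j j.2).1
  lia

/-- Two disjoint independent sets of size `q` or `q + 1` whose complement is independent and of
suitable size yield an equitable coloring. -/
theorem HasEquitableColoring.of_indep_sets {V : Type*} [Fintype V] [DecidableEq V]
    {G : SimpleGraph V} {p q : ℕ} {A B : Finset V} (hAB : Disjoint A B)
    (hA : ∀ u ∈ A, ∀ v ∈ A, ¬G.Adj u v) (hB : ∀ u ∈ B, ∀ v ∈ B, ¬G.Adj u v)
    (hZ : ∀ u ∉ A ∪ B, ∀ v ∉ A ∪ B, ¬G.Adj u v)
    (hAq : q ≤ A.card ∧ A.card ≤ q + 1) (hBq : q ≤ B.card ∧ B.card ≤ q + 1)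
    (hlo : p * q + A.card + B.card ≤ Fintype.card V)
    (hhi : Fintype.card V ≤ p * (q + 1) + A.card + B.card) :
    HasEquitableColoring G (p + 2) := by
  have hc : (A ∪ B)ᶜ.card = Fintype.card V - (A.card + B.card) := by
    rw [Finset.card_compl, Finset.card_union_of_disjoint hAB]
  obtain ⟨f, hf, hfib⟩ := exists_fibers_card_le p q (A ∪ B)ᶜ (by lia) (by lia)
  have hf' : ∀ v, v ∉ A → v ∉ B → f v < p := fun v h1 h2 => hf v (by simp [h1, h2])
  have hBA : ∀ v ∈ B, v ∉ A := fun v hB hA => Finset.disjoint_left.1 hAB hA hB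
  refine .of_nat_coloring (q := q)
    (fun v => if v ∈ A then p else if v ∈ B then p + 1 else f v) ?_ ?_ ?_
  · intro v
    grind
  · intro u v huv
    have := hA u
    have := hB u
    have := hZ u
    grind
  · intro i hi
    obtain hip | rfl | rfl : i < p ∨ i = p ∨ i = p + 1 := by lia
    · convert hfib i hip using 2 <;>
      · rw [← Set.ncard_coe_finset]
        congr 1
        ext v
        simp
        grind
    · convert hAq using 2 <;>
      · rw [← Set.ncard_coe_finset]
        congr 1
        ext v
        simp
        grind
    · convert hBq using 2 <;>
      · rw [← Set.ncard_coe_finset]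
        congr 1
        ext v
        simp
        grind

/-- A bipartite graph with parts `X`, `Y` and fewer edges than vertices has an equitable coloring
with `k = p + 3` colors, if the smaller part `X` has about one `k`-th of the vertices. -/
theorem hasEquitableColoring_of_bipartite {V : Type*} [Fintype V] [DecidableEq V]
    {G : SimpleGraph V} [DecidableRel G.Adj] {p : ℕ} {X Y : Finset V}
    (hdisj : Disjoint X Y) (hunion : X ∪ Y = Finset.univ)
    (hX : ∀ u ∈ X, ∀ v ∈ X, ¬G.Adj u v) (hY : ∀ u ∈ Y, ∀ v ∈ Y, ¬G.Adj u v)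
    (hX0 : 0 < X.card) (hsum : ∑ x ∈ X, G.degree x < Fintype.card V)
    (hhi : Fintype.card V + 1 ≤ (p + 3) * (X.card + 1))
    (hlo : (p + 2) * (X.card + 1) ≤ Fintype.card V) :
    HasEquitableColoring G (p + 3) := by
  have hcard : X.card + Y.card = Fintype.card V := by
    rw [← Finset.card_union_of_disjoint hdisj, hunion, Finset.card_univ]
  obtain ⟨q, r, hr, hn⟩ : ∃ q r, r < p + 3 ∧ Fintype.card V = (p + 3) * q + r :=
    ⟨_, _, Nat.mod_lt _ (by lia), (Nat.div_add_mod (Fintype.card V) (p + 3)).symm⟩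
  have hqm : q ≤ X.card := by
    by_contra! h
    nlinarith [Nat.mul_le_mul_left (p + 3) (Nat.succ_le_of_lt h)]
  obtain ⟨L, hL⟩ := Nat.exists_eq_add_of_le hqm
  have hkL : (p + 3) * L ≤ X.card := by
    rw [hn] at hlo
    nlinarith
  obtain ⟨S, hSX, hS, hSsum⟩ :=
    exists_subset_card_mul_sum_le X (fun x => G.degree x) (L := L) (by lia)
  have hN : (S.biUnion fun x => G.neighborFinset x).card ≤ q := by
    have h1 : (S.biUnion fun x => G.neighborFinset x).card ≤ ∑ x ∈ S, G.degree x :=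
      Finset.card_biUnion_le
    refine h1.trans ?_
    have h2 : (p + 3) * ∑ x ∈ S, G.degree x ≤ ∑ x ∈ X, G.degree x := by
      refine Nat.le_of_mul_le_mul_left (c := X.card) ?_ hX0
      calc X.card * ((p + 3) * ∑ x ∈ S, G.degree x)
          = (p + 3) * (X.card * ∑ x ∈ S, G.degree x) := by ring
        _ ≤ (p + 3) * (L * ∑ x ∈ X, G.degree x) := Nat.mul_le_mul_left _ hSsum
        _ = ((p + 3) * L) * ∑ x ∈ X, G.degree x := by ring
        _ ≤ _ := Nat.mul_le_mul_right _ hkL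
    by_contra! h
    nlinarith [Nat.mul_le_mul_left (p + 3) (Nat.succ_le_of_lt h)]
  obtain ⟨s, hqs, hsq, hs1, hs2, hs3⟩ : ∃ s, q ≤ s ∧ s ≤ q + 1 ∧
      (p + 1) * q + q + s ≤ Fintype.card V ∧ Fintype.card V ≤ (p + 1) * (q + 1) + q + s ∧
      2 * q + s ≤ Fintype.card V := by
    rcases Nat.eq_zero_or_pos r with rfl | hr0
    · exact ⟨q, by lia, by lia, by nlinarith, by nlinarith, by nlinarith⟩
    · exact ⟨q + 1, by lia, by lia, by nlinarith, by nlinarith, by nlinarith⟩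
  have hLq : L ≤ q := by nlinarith
  obtain ⟨W, hWY, hW⟩ : ∃ W ⊆ Y \ S.biUnion fun x => G.neighborFinset x, W.card = s - L := by
    apply Finset.exists_subset_card_eq
    have := Finset.le_card_sdiff (S.biUnion fun x => G.neighborFinset x) Y
    lia
  have hWY' : W ⊆ Y := hWY.trans Finset.sdiff_subset
  have hSW : ∀ u ∈ S, ∀ v ∈ W, ¬G.Adj u v := fun u hu v hv huv =>
    (Finset.mem_sdiff.1 (hWY hv)).2
      (Finset.mem_biUnion.2 ⟨u, hu, by simpa using huv⟩)
  have hA : (X \ S).card = q := by rw [Finset.card_sdiff_of_subset hSX]; lia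
  have hB : (S ∪ W).card = s := by
    rw [Finset.card_union_of_disjoint (hdisj.mono hSX hWY')]; lia
  have hcov : ∀ v, v ∈ X ∨ v ∈ Y := fun v => by
    rw [← Finset.mem_union, hunion]; exact Finset.mem_univ v
  refine .of_indep_sets (p := p + 1) (q := q) (A := X \ S) (B := S ∪ W) ?_ ?_ ?_ ?_
    (by lia) (by lia) (by lia) (by lia)
  · rw [Finset.disjoint_union_right]
    exact ⟨Finset.sdiff_disjoint, hdisj.mono Finset.sdiff_subset hWY'⟩
  · exact fun u hu v hv => hX u (Finset.mem_sdiff.1 hu).1 v (Finset.mem_sdiff.1 hv).1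
  · intro u hu v hv huv
    rcases Finset.mem_union.1 hu with hu | hu <;> rcases Finset.mem_union.1 hv with hv | hv
    · exact hX u (hSX hu) v (hSX hv) huv
    · exact hSW u hu v hv huv
    · exact hSW v hv u hu huv.symm
    · exact hY u (hWY' hu) v (hWY' hv) huv
  · have hmem : ∀ v ∉ X \ S ∪ (S ∪ W), v ∈ Y := fun v hv =>
      (hcov v).resolve_left fun h => by simp at hv; tauto
    exact fun u hu v hv => hY u (hmem u hu) v (hmem v hv)

/-- The bound on the equitable chromatic number of a tree, when `X` is the smaller part. -/
theorem eqChromNum_le_of_card_le {V : Type*} [Fintype V] [DecidableEq V] {T : SimpleGraph V}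
    (hT : T.IsTree) (hcard : 2 ≤ Fintype.card V) {X Y : Finset V}
    (hdisj : Disjoint X Y) (hunion : X ∪ Y = Finset.univ)
    (hX : ∀ u ∈ X, ∀ v ∈ X, ¬T.Adj u v) (hY : ∀ u ∈ Y, ∀ v ∈ Y, ¬T.Adj u v)
    (hXY : X.card ≤ Y.card) :
    eqChromNum T ≤ (X.card + Y.card + 1 + (X.card + 1) - 1) / (X.card + 1) := by
  classical
  have hn : X.card + Y.card = Fintype.card V := by
    rw [← Finset.card_union_of_disjoint hdisj, hunion, Finset.card_univ]
  have hcov : ∀ v, v ∈ X ∨ v ∈ Y := fun v => by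
    rw [← Finset.mem_union, hunion]; exact Finset.mem_univ v
  have hbip : T.IsBipartiteWith (X : Set V) (Y : Set V) := by
    refine ⟨by exact_mod_cast hdisj, fun u v huv => ?_⟩
    have h1 := fun h h' => hX u h v h' huv
    have h2 := fun h h' => hY u h v h' huv
    have h3 := hcov u
    have h4 := hcov v
    simp only [Finset.mem_coe]
    tauto
  have hsum : ∑ x ∈ X, T.degree x = T.edgeFinset.card :=
    SimpleGraph.isBipartiteWith_sum_degrees_eq_card_edges hbip
  have hedge := hT.card_edgeFinset
  have hX0 : 0 < X.card := by
    by_contra! h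
    obtain rfl : X = ∅ := by simpa using h
    simp only [Finset.sum_empty] at hsum
    lia
  apply Nat.sInf_le
  rw [Set.mem_ofPred_eq, hn]
  set k := (Fintype.card V + 1 + (X.card + 1) - 1) / (X.card + 1)
  have hk1 : k * (X.card + 1) ≤ Fintype.card V + 1 + (X.card + 1) - 1 := Nat.div_mul_le_self _ _
  have hk2 : Fintype.card V + 1 + (X.card + 1) - 1 < (k + 1) * (X.card + 1) := by
    have := Nat.lt_mul_div_succ (Fintype.card V + 1 + (X.card + 1) - 1) X.card.succ_pos
    rw [mul_comm]
    exact this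
  clear_value k
  match k with
  | 0 => lia
  | 1 => lia
  | 2 =>
    exact .of_indep_sets (p := 0) (q := X.card) hdisj hX hY (by simp [hunion])
      (by lia) (by lia) (by lia) (by lia)
  | p + 3 =>
    have h1 : (p + 3) * (X.card + 1) = (p + 2) * (X.card + 1) + (X.card + 1) := by ring
    have h2 : (p + 3 + 1) * (X.card + 1) = (p + 3) * (X.card + 1) + (X.card + 1) := by ring
    exact hasEquitableColoring_of_bipartite hdisj hunion hX hY hX0 (by lia) (by lia) (by lia)

theorem stmt7 (V : Type) [Fintype V] [DecidableEq V] (T : SimpleGraph V) (hT : T.IsTree)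
    (hcard : 2 ≤ Fintype.card V) (X Y : Finset V)
    (hdisj : Disjoint X Y) (hunion : X ∪ Y = Finset.univ)
    (hX : ∀ u ∈ X, ∀ v ∈ X, ¬T.Adj u v) (hY : ∀ u ∈ Y, ∀ v ∈ Y, ¬T.Adj u v) :
    eqChromNum T ≤
      (X.card + Y.card + 1 + (min X.card Y.card + 1) - 1) / (min X.card Y.card + 1) := by
  rcases le_total X.card Y.card with h | h
  · rw [min_eq_left h]
    exact eqChromNum_le_of_card_le hT hcard hdisj hunion hX hY h
  · rw [min_eq_right h, add_comm X.card]
    exact eqChromNum_le_of_card_le hT hcard hdisj.symm (by rwa [Finset.union_comm]) hY hX h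
end
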